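/- Assume the resonance condition and let p₁, p₂ be continuous and 2π-periodic. Suppose there exists ω* = (ω₁*, ω₂*) ∈ ℝ² such that Φ₁(ω₁*) = Φ₂(ω₂*) = 0 and Φ_i'(ω_i*) < 0 for i = 1,2. Then there exists φ* > 0 (depending only on n, a₁, a₂, b₁, b₂, p₁, p₂) such that: for every pair of functions φ₁, φ₂ : ℝ → ℝ that are locally Lipschitz and bounded, admit limits φ_i(±∞) = lim_{x→±∞} φ_i(x) with φ_i(−∞) = −φ_i(+∞), and satisfy |φ_i(+∞)| < φ* for i = 1,2, there exists a Lebesgue-measurable set E ⊆ ℝ⁴ of infinite Lebesgue measure such that every C² solution x = (x₁,x₂) : [0,∞) → ℝ² of the corresponding system (S) with (x₁(0), x₂(0), ẋ₁(0), ẋ₂(0)) ∈ E satisfies lim_{t→+∞} (x_i(t)² + ẋ_i(t)²) = +∞ for i = 1,2. -/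

import Mathlib

open Real MeasureTheory Filter

noncomputable section

/-- `C` is the asymmetric cosine of the pair `(a, b)` for the resonance integer `n`:
the even, `2π/n`-periodic function equal to `cos(√a t)` on `[0, π/(2√a)]` and to
`−√(a/b)·sin(√b(t − π/(2√a)))` on `[π/(2√a), π/n]`. -/
def IsAsymCos (n : ℕ) (a b : ℝ) (C : ℝ → ℝ) : Prop :=
  (∀ t, C (-t) = C t) ∧ (∀ t, C (t + 2 * π / n) = C t) ∧
  (∀ t ∈ Set.Icc (0 : ℝ) (π / (2 * Real.sqrt a)), C t = Real.cos (Real.sqrt a * t)) ∧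
  (∀ t ∈ Set.Icc (π / (2 * Real.sqrt a)) (π / n),
      C t = - Real.sqrt (a / b) * Real.sin (Real.sqrt b * (t - π / (2 * Real.sqrt a))))

/-! ### The restoring force and the potential -/

def gg (a b x : ℝ) : ℝ := a * max x 0 - b * max (-x) 0

def qq (a b x : ℝ) : ℝ := a * (max x 0) ^ 2 + b * (max (-x) 0) ^ 2

lemma gg_of_nonneg {a b x : ℝ} (h : 0 ≤ x) : gg a b x = a * x := by
  simp [gg, max_eq_left h, max_eq_right (neg_nonpos.2 h)]

lemma gg_of_nonpos {a b x : ℝ} (h : x ≤ 0) : gg a b x = b * x := by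
  simp [gg, max_eq_right h, max_eq_left (neg_nonneg.2 h)]

lemma qq_of_nonneg {a b x : ℝ} (h : 0 ≤ x) : qq a b x = a * x ^ 2 := by
  simp [qq, max_eq_left h, max_eq_right (neg_nonpos.2 h)]

lemma qq_of_nonpos {a b x : ℝ} (h : x ≤ 0) : qq a b x = b * x ^ 2 := by
  simp [qq, max_eq_right h, max_eq_left (neg_nonneg.2 h)]

lemma gg_mul_self (a b x : ℝ) : x * gg a b x = qq a b x := by
  rcases le_total 0 x with h | h
  · rw [gg_of_nonneg h, qq_of_nonneg h]; ring
  · rw [gg_of_nonpos h, qq_of_nonpos h]; ring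

lemma gg_smul {a b r : ℝ} (hr : 0 ≤ r) (x : ℝ) : gg a b (r * x) = r * gg a b x := by
  rcases le_total 0 x with h | h
  · rw [gg_of_nonneg h, gg_of_nonneg (mul_nonneg hr h)]; ring
  · rw [gg_of_nonpos h, gg_of_nonpos (mul_nonpos_of_nonneg_of_nonpos hr h)]; ring

lemma qq_smul {a b r : ℝ} (hr : 0 ≤ r) (x : ℝ) : qq a b (r * x) = r ^ 2 * qq a b x := by
  rcases le_total 0 x with h | h
  · rw [qq_of_nonneg h, qq_of_nonneg (mul_nonneg hr h)]; ring
  · rw [qq_of_nonpos h, qq_of_nonpos (mul_nonpos_of_nonneg_of_nonpos hr h)]; ring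

lemma gg_lip {a b : ℝ} (ha : 0 < a) (hb : 0 < b) (x y : ℝ) :
    |gg a b x - gg a b y| ≤ (a + b) * |x - y| := by
  have h1 : |max x 0 - max y 0| ≤ |x - y| := abs_max_sub_max_le_abs x y 0
  have h2 : |max (-x) 0 - max (-y) 0| ≤ |x - y| := by
    have := abs_max_sub_max_le_abs (-x) (-y) 0
    rwa [show -x - -y = -(x - y) by ring, abs_neg] at this
  have : gg a b x - gg a b y = a * (max x 0 - max y 0) + -(b * (max (-x) 0 - max (-y) 0)) := by
    unfold gg; ring
  rw [this]
  refine (abs_add_le _ _).trans ?_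
  rw [abs_neg, abs_mul, abs_mul, abs_of_pos ha, abs_of_pos hb]
  nlinarith

lemma gg_cont (a b : ℝ) : Continuous (gg a b) := by
  unfold gg; fun_prop

lemma gg_cross {a b : ℝ} (ha : 0 < a) (hb : 0 < b) (x y : ℝ) :
    |x * gg a b y - gg a b x * y| ≤ (a + b) * (x - y) ^ 2 := by
  have key : ∀ u v : ℝ, 0 ≤ u → v ≤ 0 → |(b - a) * (u * v)| ≤ (a + b) * (u - v) ^ 2 := by
    intro u v hu hv
    rw [abs_mul, abs_of_nonpos (mul_nonpos_of_nonneg_of_nonpos hu hv)]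
    have h1 : |b - a| ≤ a + b := by rw [abs_le]; constructor <;> linarith
    have h2 : 0 ≤ -(u * v) := by nlinarith
    have h3 : -(u * v) ≤ (u - v) ^ 2 := by nlinarith [sq_nonneg u, sq_nonneg v]
    exact mul_le_mul h1 h3 h2 (by positivity)
  have hp : 0 ≤ (a + b) * (x - y) ^ 2 := by positivity
  rcases le_total 0 x with hx | hx <;> rcases le_total 0 y with hy | hy
  · rw [gg_of_nonneg hx, gg_of_nonneg hy]
    rw [show x * (a * y) - a * x * y = 0 by ring, abs_zero]; exact hp
  · rw [gg_of_nonneg hx, gg_of_nonpos hy]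
    rw [show x * (b * y) - a * x * y = (b - a) * (x * y) by ring]; exact key x y hx hy
  · rw [gg_of_nonpos hx, gg_of_nonneg hy]
    rw [show x * (a * y) - b * x * y = -((b - a) * (y * x)) by ring, abs_neg,
      show (x - y) ^ 2 = (y - x) ^ 2 by ring]
    exact key y x hy hx
  · rw [gg_of_nonpos hx, gg_of_nonpos hy]
    rw [show x * (b * y) - b * x * y = 0 by ring, abs_zero]; exact hp

/-! ### Gluing derivatives -/

lemma glue_at {f f1 f2 : ℝ → ℝ} {p q r d : ℝ} (hpq : p < q) (hqr : q < r)
    (h1 : ∀ t ∈ Set.Icc p q, f t = f1 t) (h2 : ∀ t ∈ Set.Icc q r, f t = f2 t)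
    (d1 : HasDerivAt f1 d q) (d2 : HasDerivAt f2 d q) : HasDerivAt f d q := by
  have l : HasDerivWithinAt f d (Set.Iic q) q := by
    refine (d1.hasDerivWithinAt).congr_of_eventuallyEq ?_ (h1 q ⟨hpq.le, le_rfl⟩)
    filter_upwards [Icc_mem_nhdsLE hpq] with t ht using h1 t ht
  have r : HasDerivWithinAt f d (Set.Ici q) q := by
    refine (d2.hasDerivWithinAt).congr_of_eventuallyEq ?_ (h2 q ⟨le_rfl, hqr.le⟩)
    filter_upwards [Icc_mem_nhdsGE hqr] with t ht using h2 t ht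
  have := l.union r
  rwa [Set.Iic_union_Ici, hasDerivWithinAt_univ] at this

lemma glue_int {f f1 : ℝ → ℝ} {p q d t : ℝ} (hpt : p < t) (htq : t < q)
    (h1 : ∀ t ∈ Set.Icc p q, f t = f1 t) (d1 : HasDerivAt f1 d t) : HasDerivAt f d t := by
  refine d1.congr_of_eventuallyEq ?_
  filter_upwards [Icc_mem_nhds hpt htq] with t ht using h1 t ht

lemma glue_periodic {f f1 f2 f1' f2' : ℝ → ℝ} {p q P : ℝ} (hpq : p < q) (hqP : q < p + P)
    (hper : Function.Periodic f P)
    (h1 : ∀ t ∈ Set.Icc p q, f t = f1 t) (h2 : ∀ t ∈ Set.Icc q (p + P), f t = f2 t)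
    (d1 : ∀ t, HasDerivAt f1 (f1' t) t) (d2 : ∀ t, HasDerivAt f2 (f2' t) t)
    (e1 : f1' q = f2' q) (e2 : f1' p = f2' (p + P)) :
    (∀ t, HasDerivAt f (deriv f t) t) ∧ (∀ t ∈ Set.Icc p q, deriv f t = f1' t) ∧
      (∀ t ∈ Set.Icc q (p + P), deriv f t = f2' t) ∧ Function.Periodic (deriv f) P := by
  have hdper : ∀ t d, HasDerivAt f d t → HasDerivAt f d (t + P) := by
    intro t d h
    have h3 : HasDerivAt (fun s => f (s - P)) d (t + P) := by
      apply HasDerivAt.comp_sub_const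
      simpa using h
    have h4 : (fun s => f (s - P)) = f := by
      ext s; have := hper (s - P); rw [sub_add_cancel] at this; exact this.symm
    rwa [h4] at h3
  have hq : HasDerivAt f (f1' q) q := glue_at hpq hqP h1 h2 (d1 q) (e1 ▸ d2 q)
  have hp : HasDerivAt f (f1' p) p := by
    refine glue_at (p := q - P) (f1 := fun s => f2 (s + P)) (by linarith) hpq ?_ h1 ?_ (d1 p)
    · intro t ht
      rw [← hper t]; exact h2 _ ⟨by linarith [ht.1], by linarith [ht.2]⟩
    · rw [e2]; exact (d2 (p + P)).comp_add_const p P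
  have hpP : HasDerivAt f (f1' p) (p + P) := hdper _ _ hp
  have A1 : ∀ t ∈ Set.Icc p q, HasDerivAt f (f1' t) t := by
    intro t ht
    rcases eq_or_lt_of_le ht.1 with h | h
    · rw [← h]; exact hp
    rcases eq_or_lt_of_le ht.2 with h' | h'
    · rw [h']; exact hq
    exact glue_int h h' h1 (d1 t)
  have A2 : ∀ t ∈ Set.Icc q (p + P), HasDerivAt f (f2' t) t := by
    intro t ht
    rcases eq_or_lt_of_le ht.1 with h | h
    · rw [← h, ← e1]; exact hq
    rcases eq_or_lt_of_le ht.2 with h' | h'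
    · rw [h', ← e2]; exact hpP
    exact glue_int h h' h2 (d2 t)
  have hP : 0 < P := by linarith
  refine ⟨?_, fun t ht => (A1 t ht).deriv, fun t ht => (A2 t ht).deriv, ?_⟩
  · intro t
    obtain ⟨k, hk, -⟩ := existsUnique_sub_zsmul_mem_Ico hP t p
    have hd : DifferentiableAt ℝ f (t - k • P) := by
      rcases le_total (t - k • P) q with h | h
      · exact (A1 _ ⟨hk.1, h⟩).differentiableAt
      · exact (A2 _ ⟨h, hk.2.le⟩).differentiableAt
    have h3 := hd.hasDerivAt.comp_sub_const t (k • P)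
    have h4 : (fun s => f (s - k • P)) = f := by
      ext s; exact hper.sub_zsmul_eq k
    rw [h4] at h3
    exact h3.differentiableAt.hasDerivAt
  · intro t
    have h4 : (fun s => f (s + P)) = f := funext hper
    rw [← deriv_comp_add_const, h4]

/-! ### Oscillator data -/

structure Osc (a b B : ℝ) (C S : ℝ → ℝ) : Prop where
  ha : 0 < a
  hb : 0 < b
  hB : 0 < B
  dC : ∀ t, HasDerivAt C (S t) t
  dS : ∀ t, HasDerivAt S (-gg a b (C t)) t
  pC : ∀ t, C (t + 2 * π) = C t
  pS : ∀ t, S (t + 2 * π) = S t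
  en : ∀ t, S t ^ 2 + qq a b (C t) = a
  bC : ∀ t, |C t| ≤ B
  bS : ∀ t, |S t| ≤ B

lemma hasDerivAt_maxsq (x : ℝ) : HasDerivAt (fun x : ℝ => (max x 0) ^ 2) (2 * max x 0) x := by
  rcases lt_trichotomy x 0 with h | h | h
  · rw [max_eq_right h.le, mul_zero]
    refine (hasDerivAt_const x (0 : ℝ)).congr_of_eventuallyEq ?_
    filter_upwards [Iio_mem_nhds h] with y hy
    simp [max_eq_right (Set.mem_Iio.1 hy).le]
  · subst h
    refine glue_at (p := -1) (r := 1) (f1 := fun _ => 0) (f2 := fun x => x ^ 2) (by norm_num)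
      (by norm_num) ?_ ?_ ?_ ?_
    · intro t ht; simp [max_eq_right ht.2]
    · intro t ht; simp [max_eq_left ht.1]
    · simpa using hasDerivAt_const (0 : ℝ) (0 : ℝ)
    · simpa using hasDerivAt_pow 2 (0 : ℝ)
  · rw [max_eq_left h.le]
    have := hasDerivAt_pow 2 x
    simp at this
    refine this.congr_of_eventuallyEq ?_
    filter_upwards [Ioi_mem_nhds h] with y hy
    simp [max_eq_left (Set.mem_Ioi.1 hy).le]

lemma hasDerivAt_qq (a b x : ℝ) : HasDerivAt (qq a b) (2 * gg a b x) x := by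
  have h1 := (hasDerivAt_maxsq x).const_mul a
  have h2 : HasDerivAt (fun x : ℝ => (max (-x) 0) ^ 2) (2 * max (-x) 0 * (-1)) x :=
    (hasDerivAt_maxsq (-x)).comp x (hasDerivAt_neg x)
  have h3 := h1.add (h2.const_mul b)
  refine h3.congr_deriv ?_
  unfold gg; ring

lemma isAsymCos_osc {n : ℕ} (hn : 1 ≤ n) {a b : ℝ} (ha : 0 < a) (hb : 0 < b)
    (hres : 1 / √a + 1 / √b = 2 / (n : ℝ)) {C : ℝ → ℝ} (hC : IsAsymCos n a b C) :
    ∃ B, Osc a b B C (deriv C) := by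
  obtain ⟨hev, hper, hc1, hc2⟩ := hC
  have hn0 : (0 : ℝ) < n := by exact_mod_cast hn
  have hsa : 0 < √a := Real.sqrt_pos.2 ha
  have hsb : 0 < √b := Real.sqrt_pos.2 hb
  have hpi := Real.pi_pos
  have haa : √a * √a = a := Real.mul_self_sqrt ha.le
  have hbb : √b * √b = b := Real.mul_self_sqrt hb.le
  set t₁ := π / (2 * √a) with ht1
  set P := 2 * π / n with hPdef
  have ht1pos : 0 < t₁ := by positivity
  have hat : √a * t₁ = π / 2 := by rw [ht1]; field_simp
  have hP : P = 2 * t₁ + π / √b := by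
    have : P = π * (2 / (n : ℝ)) := by rw [hPdef]; ring
    rw [this, ← hres, ht1]; field_simp
  have hbp : √b * (P - 2 * t₁) = π := by rw [hP]; field_simp; ring
  have hhalf : π / (n : ℝ) = P / 2 := by rw [hPdef]; ring
  have hpb : 0 < π / √b := by positivity
  have hab : √(a / b) * √b = √a := by
    rw [Real.sqrt_div ha.le]; field_simp
  have h1 : ∀ t ∈ Set.Icc (-t₁) t₁, C t = Real.cos (√a * t) := by
    intro t ht
    rcases le_total 0 t with h | h
    · exact hc1 t ⟨h, ht.2⟩
    · rw [← hev t, hc1 (-t) ⟨by linarith, by linarith [ht.1]⟩, mul_neg, Real.cos_neg]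
  have h2 : ∀ t ∈ Set.Icc t₁ (-t₁ + P), C t = -√(a / b) * Real.sin (√b * (t - t₁)) := by
    intro t ht
    rcases le_total t (P / 2) with h | h
    · exact hc2 t ⟨ht.1, by rw [hhalf]; exact h⟩
    · rw [← hev t, ← hper (-t), hc2 (-t + P) ⟨by linarith [ht.2], by rw [hhalf]; linarith⟩]
      rw [show √b * (-t + P - t₁) = √b * (P - 2 * t₁) - √b * (t - t₁) by ring, hbp,
        Real.sin_pi_sub]
  have d1 : ∀ t, HasDerivAt (fun t => Real.cos (√a * t)) (-√a * Real.sin (√a * t)) t := by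
    intro t
    have := ((hasDerivAt_id t).const_mul √a).cos
    refine this.congr_deriv ?_
    simp; ring
  have d2 : ∀ t, HasDerivAt (fun t => -√(a / b) * Real.sin (√b * (t - t₁)))
      (-√a * Real.cos (√b * (t - t₁))) t := by
    intro t
    have := ((((hasDerivAt_id t).sub_const t₁).const_mul √b).sin).const_mul (-√(a / b))
    refine this.congr_deriv ?_
    rw [← hab]; simp; ring
  have e1 : -√a * Real.sin (√a * t₁) = -√a * Real.cos (√b * (t₁ - t₁)) := by
    rw [hat]; simp
  have e2 : -√a * Real.sin (√a * -t₁) = -√a * Real.cos (√b * (-t₁ + P - t₁)) := by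
    rw [show √b * (-t₁ + P - t₁) = √b * (P - 2 * t₁) by ring, hbp, mul_neg, hat]; simp
  obtain ⟨D, D1, D2, D3⟩ := glue_periodic (f1' := fun t => -√a * Real.sin (√a * t))
    (f2' := fun t => -√a * Real.cos (√b * (t - t₁)))
    (by linarith : -t₁ < t₁) (by linarith : t₁ < -t₁ + P) hper h1 h2 d1 d2 e1 e2
  have dd1 : ∀ t, HasDerivAt (fun t => -√a * Real.sin (√a * t)) (-a * Real.cos (√a * t)) t := by
    intro t
    have := (((hasDerivAt_id t).const_mul √a).sin).const_mul (-√a)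
    refine this.congr_deriv ?_
    nth_rewrite 4 [← haa]
    simp; ring
  have dd2 : ∀ t, HasDerivAt (fun t => -√a * Real.cos (√b * (t - t₁)))
      (√a * √b * Real.sin (√b * (t - t₁))) t := by
    intro t
    have := ((((hasDerivAt_id t).sub_const t₁).const_mul √b).cos).const_mul (-√a)
    refine this.congr_deriv ?_
    simp; ring
  have ee1 : -a * Real.cos (√a * t₁) = √a * √b * Real.sin (√b * (t₁ - t₁)) := by
    rw [hat]; simp
  have ee2 : -a * Real.cos (√a * -t₁) = √a * √b * Real.sin (√b * (-t₁ + P - t₁)) := by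
    rw [show √b * (-t₁ + P - t₁) = √b * (P - 2 * t₁) by ring, hbp, mul_neg, Real.cos_neg, hat]
    simp
  obtain ⟨G, G1, G2, G3⟩ := glue_periodic (f1' := fun t => -a * Real.cos (√a * t))
    (f2' := fun t => √a * √b * Real.sin (√b * (t - t₁)))
    (by linarith : -t₁ < t₁) (by linarith : t₁ < -t₁ + P) D3 D1 D2 dd1 dd2 ee1 ee2
  have hperC : Function.Periodic C P := hper
  have hP0 : 0 < P := by linarith
  have hode : ∀ t, deriv (deriv C) t = -gg a b (C t) := by
    intro t
    obtain ⟨k, hk, -⟩ := existsUnique_sub_zsmul_mem_Ico hP0 t (-t₁)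
    rw [← hperC.sub_zsmul_eq k, ← G3.sub_zsmul_eq k]
    generalize t - k • P = s at hk
    rcases le_total s t₁ with h | h
    · rw [G1 s ⟨hk.1, h⟩, h1 s ⟨hk.1, h⟩, gg_of_nonneg]
      · ring
      · apply Real.cos_nonneg_of_mem_Icc
        rw [← hat]
        constructor
        · nlinarith [hk.1]
        · nlinarith
    · rw [G2 s ⟨h, hk.2.le⟩, h2 s ⟨h, hk.2.le⟩, gg_of_nonpos]
      · rw [← hab]; linear_combination (√(a / b) * Real.sin (√b * (s - t₁))) * hbb
      · have : 0 ≤ Real.sin (√b * (s - t₁)) := by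
          apply Real.sin_nonneg_of_nonneg_of_le_pi
          · exact mul_nonneg hsb.le (by linarith)
          · rw [← hbp]; exact mul_le_mul_of_nonneg_left (by linarith [hk.2]) hsb.le
        have h5 := Real.sqrt_nonneg (a / b)
        nlinarith [mul_nonneg h5 this]
  have hnP : (n : ℝ) * P = 2 * π := by rw [hPdef]; field_simp
  have p1 : ∀ t, C (t + 2 * π) = C t := by
    intro t; rw [← hnP]; exact hperC.nat_mul n t
  have p2 : ∀ t, deriv C (t + 2 * π) = deriv C t := by
    intro t; rw [← hnP]; exact D3.nat_mul n t
  have hdS : ∀ t, HasDerivAt (deriv C) (-gg a b (C t)) t := fun t => hode t ▸ G t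
  have hen : ∀ t, deriv C t ^ 2 + qq a b (C t) = a := by
    have hder : ∀ t, HasDerivAt (fun t => deriv C t ^ 2 + qq a b (C t)) 0 t := by
      intro t
      have h5 := ((hdS t).pow 2).add ((hasDerivAt_qq a b (C t)).comp t (D t))
      refine h5.congr_deriv ?_
      simp; ring
    intro t
    have := is_const_of_deriv_eq_zero (fun t => (hder t).differentiableAt)
      (fun t => (hder t).deriv) t 0
    rw [this, D1 0 ⟨by linarith, by linarith⟩, h1 0 ⟨by linarith, by linarith⟩, qq_of_nonneg] <;> simp
  have cC : Continuous C := continuous_iff_continuousAt.2 fun t => (D t).continuousAt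
  have cS : Continuous (deriv C) := continuous_iff_continuousAt.2 fun t => (G t).continuousAt
  have bd : ∀ f : ℝ → ℝ, Continuous f → (∀ t, f (t + 2 * π) = f t) → ∃ B, ∀ t, |f t| ≤ B := by
    intro f hf hp
    obtain ⟨B, hB⟩ := (isCompact_Icc (a := (0 : ℝ)) (b := 2 * π)).exists_bound_of_continuousOn hf.continuousOn
    refine ⟨B, fun t => ?_⟩
    have hp' : Function.Periodic f (2 * π) := hp
    obtain ⟨y, hy, e⟩ := hp'.exists_mem_Ico₀ (by positivity) t
    rw [e]; exact hB y ⟨hy.1, hy.2.le⟩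
  obtain ⟨B1, hB1⟩ := bd C cC p1
  obtain ⟨B2, hB2⟩ := bd _ cS p2
  refine ⟨max (max B1 B2) 1, ha, hb, by positivity, D, hdS, p1, p2, hen, ?_, ?_⟩
  · intro t; exact (hB1 t).trans ((le_max_left _ _).trans (le_max_left _ _))
  · intro t; exact (hB2 t).trans ((le_max_right _ _).trans (le_max_left _ _))

namespace Osc

variable {a b B : ℝ} {C S : ℝ → ℝ}

lemma cC (o : Osc a b B C S) : Continuous C :=
  continuous_iff_continuousAt.2 fun t => (o.dC t).continuousAt

lemma cS (o : Osc a b B C S) : Continuous S :=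
  continuous_iff_continuousAt.2 fun t => (o.dS t).continuousAt

lemma bg (o : Osc a b B C S) (t : ℝ) : |gg a b (C t)| ≤ (a + b) * B := by
  have h := gg_lip o.ha o.hb (C t) 0
  have h0 : gg a b 0 = 0 := by simp [gg]
  rw [h0, sub_zero, sub_zero] at h
  have h1 := o.ha
  have h2 := o.hb
  exact h.trans (mul_le_mul_of_nonneg_left (o.bC t) (by linarith))

lemma lC (o : Osc a b B C S) (s t : ℝ) : |C s - C t| ≤ B * |s - t| :=
  Convex.norm_image_sub_le_of_norm_hasDerivWithin_le (s := Set.univ)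
    (fun x _ => (o.dC x).hasDerivWithinAt) (fun x _ => o.bS x) convex_univ trivial trivial

lemma lS (o : Osc a b B C S) (s t : ℝ) : |S s - S t| ≤ (a + b) * B * |s - t| :=
  Convex.norm_image_sub_le_of_norm_hasDerivWithin_le (s := Set.univ)
    (fun x _ => (o.dS x).hasDerivWithinAt)
    (fun x _ => by rw [Real.norm_eq_abs, abs_neg]; exact o.bg x) convex_univ trivial trivial

lemma exists_delta (o : Osc a b B C S) : ∃ δ₀ > 0, ∀ τ σ, |σ - τ| ≤ δ₀ →
    a / 2 ≤ C τ * gg a b (C σ) + S τ * S σ := by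
  have ha := o.ha
  have hb := o.hb
  have hB := o.hB
  refine ⟨a / (4 * (a + b) * B ^ 2), by positivity, ?_⟩
  intro τ σ h
  rw [abs_sub_comm] at h
  rw [le_div_iff₀ (by positivity)] at h
  have h1 : |(C τ - C σ) * gg a b (C σ)| ≤ (B * |τ - σ|) * ((a + b) * B) := by
    rw [abs_mul]
    exact mul_le_mul (o.lC τ σ) (o.bg σ) (abs_nonneg _) (by positivity)
  have h2 : |(S τ - S σ) * S σ| ≤ ((a + b) * B * |τ - σ|) * B := by
    rw [abs_mul]
    exact mul_le_mul (o.lS τ σ) (o.bS σ) (abs_nonneg _) (by positivity)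
  have h3 := o.en σ
  rw [← gg_mul_self] at h3
  have h4 := (abs_le.1 h1).1
  have h5 := (abs_le.1 h2).1
  nlinarith

lemma cross_le (o : Osc a b B C S) {δ₀ : ℝ}
    (hD : ∀ τ σ, |σ - τ| ≤ δ₀ → a / 2 ≤ C τ * gg a b (C σ) + S τ * S σ)
    {τ σ : ℝ} (h1 : τ ≤ σ) (h2 : σ - τ ≤ δ₀) :
    C τ * S σ - S τ * C σ ≤ -(a / 2) * (σ - τ) := by
  have hd : ∀ s, HasDerivAt (fun s => C τ * S s - S τ * C s)
      (C τ * -gg a b (C s) - S τ * S s) s := fun s =>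
    ((o.dS s).const_mul (C τ)).sub ((o.dC s).const_mul (S τ))
  have := Convex.image_sub_le_mul_sub_of_deriv_le (convex_Icc τ σ)
    (f := fun s => C τ * S s - S τ * C s) (C := -(a / 2))
    (fun s _ => (hd s).continuousAt.continuousWithinAt)
    (fun s _ => (hd s).differentiableAt.differentiableWithinAt) (by
      intro s hs
      have hs := interior_subset hs
      rw [(hd s).deriv]
      have := hD τ s (by rw [abs_of_nonneg (by linarith [hs.1])]; linarith [hs.2])
      linarith) τ ⟨le_rfl, h1⟩ σ ⟨h1, le_rfl⟩ h1
  have h3 : C τ * S τ - S τ * C τ = 0 := by ring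
  linarith

lemma polar (o : Osc a b B C S) {δ₀ : ℝ}
    (hD : ∀ τ σ, |σ - τ| ≤ δ₀ → a / 2 ≤ C τ * gg a b (C σ) + S τ * S σ)
    {ε K : ℝ} (hε : 0 < ε) (hεδ : ε ≤ δ₀) (hK : 0 ≤ K) :
    ∃ R > 0, ∀ ρ ≥ R, ∀ τ x v, |x - ρ * C τ| ≤ K → |v - ρ * S τ| ≤ K →
      ∃ ρ' > 0, ∃ τ', |τ' - τ| ≤ ε ∧ ρ / 4 ≤ ρ' ∧ x = ρ' * C τ' ∧ v = ρ' * S τ' := by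
  have ha := o.ha
  have hb := o.hb
  have hB := o.hB
  refine ⟨4 * K * B * (1 + a + b) / a + 4 * K * B / (a * ε) + 1, by positivity, ?_⟩
  intro ρ hρ τ x v hx hv
  have q1 : 0 ≤ 4 * K * B * (1 + a + b) / a := by positivity
  have q2 : 0 ≤ 4 * K * B / (a * ε) := by positivity
  have hρ0 : 0 < ρ := by linarith
  have r1 : 4 * K * B * (1 + a + b) ≤ ρ * a := by
    rw [← div_le_iff₀ ha]; linarith
  have r2 : 4 * K * B < ρ * (a * ε) := by
    rw [← div_lt_iff₀ (by positivity)]; linarith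
  have herr : ∀ σ, |(x * S σ - v * C σ) - ρ * (C τ * S σ - S τ * C σ)| ≤ 2 * K * B := by
    intro σ
    have e : (x * S σ - v * C σ) - ρ * (C τ * S σ - S τ * C σ)
      = (x - ρ * C τ) * S σ - (v - ρ * S τ) * C σ := by ring
    rw [e]
    refine (abs_sub _ _).trans ?_
    rw [abs_mul, abs_mul]
    have h1 := mul_le_mul hx (o.bS σ) (abs_nonneg _) hK
    have h2 := mul_le_mul hv (o.bC σ) (abs_nonneg _) hK
    linarith
  have hcont : Continuous (fun σ => x * S σ - v * C σ) := by
    have := o.cC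
    have := o.cS
    fun_prop
  have hup : x * S (τ + ε) - v * C (τ + ε) ≤ 0 := by
    have h1 := (abs_le.1 (herr (τ + ε))).2
    have h2 := o.cross_le hD (τ := τ) (σ := τ + ε) (by linarith) (by linarith)
    have h3 := mul_le_mul_of_nonneg_left h2 hρ0.le
    nlinarith
  have hlo : 0 ≤ x * S (τ - ε) - v * C (τ - ε) := by
    have h1 := (abs_le.1 (herr (τ - ε))).1
    have h2 := o.cross_le hD (τ := τ - ε) (σ := τ) (by linarith) (by linarith)
    have h3 := mul_le_mul_of_nonneg_left h2 hρ0.le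
    nlinarith
  obtain ⟨τ', hτ', h0⟩ := intermediate_value_Icc' (by linarith : τ - ε ≤ τ + ε)
    hcont.continuousOn ⟨hup, hlo⟩
  simp only at h0
  have habs : |τ' - τ| ≤ ε := by rw [abs_le]; constructor <;> linarith [hτ'.1, hτ'.2]
  have hen := o.en τ'
  rw [← gg_mul_self] at hen
  have hDD := hD τ τ' (habs.trans hεδ)
  have hlow : ρ / 4 ≤ (v * S τ' + x * gg a b (C τ')) / a := by
    rw [le_div_iff₀ ha]
    have e : v * S τ' + x * gg a b (C τ') = ρ * (C τ * gg a b (C τ') + S τ * S τ')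
      + (v - ρ * S τ) * S τ' + (x - ρ * C τ) * gg a b (C τ') := by ring
    rw [e]
    have h1 : |(v - ρ * S τ) * S τ'| ≤ K * B := by
      rw [abs_mul]; exact mul_le_mul hv (o.bS _) (abs_nonneg _) hK
    have h2 : |(x - ρ * C τ) * gg a b (C τ')| ≤ K * ((a + b) * B) := by
      rw [abs_mul]; exact mul_le_mul hx (o.bg _) (abs_nonneg _) hK
    have h3 := (abs_le.1 h1).1
    have h4 := (abs_le.1 h2).1
    have h5 := mul_le_mul_of_nonneg_left hDD hρ0.le
    nlinarith
  refine ⟨(v * S τ' + x * gg a b (C τ')) / a, by linarith, τ', habs, hlow, ?_, ?_⟩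
  · field_simp
    linear_combination (-x) * hen + S τ' * h0
  · field_simp
    linear_combination (-v) * hen - gg a b (C τ') * h0

lemma gron (o : Osc a b B C S) {F : ℝ} (hF : 0 ≤ F) :
    ∃ K ≥ 0, ∀ (f x v : ℝ → ℝ) (ρ τ : ℝ), 0 ≤ ρ →
      (∀ t ∈ Set.Icc 0 (2 * π), HasDerivAt x (v t) t ∧ HasDerivAt v (f t - gg a b (x t)) t) →
      (∀ t ∈ Set.Icc 0 (2 * π), |f t| ≤ F) → x 0 = ρ * C τ → v 0 = ρ * S τ →
      ∀ t ∈ Set.Icc 0 (2 * π), |x t - ρ * C (τ + t)| ≤ K ∧ |v t - ρ * S (τ + t)| ≤ K := by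
  have ha := o.ha
  have hb := o.hb
  have hpi := Real.pi_pos
  have hmono := gronwallBound_mono (δ := 0) (K := 1 + (a + b)) (ε := F) le_rfl hF (by linarith)
  refine ⟨gronwallBound 0 (1 + (a + b)) F (2 * π), ?_, ?_⟩
  · have := hmono (show (0 : ℝ) ≤ 2 * π by linarith)
    rwa [gronwallBound_x0] at this
  intro f x v ρ τ hρ hd hf hx0 hv0 t ht
  have hw : ∀ t ∈ Set.Icc 0 (2 * π), HasDerivAt
      (fun t => (x t - ρ * C (τ + t), v t - ρ * S (τ + t)))
      (v t - ρ * S (τ + t), f t - gg a b (x t) - ρ * -gg a b (C (τ + t))) t := by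
    intro t ht
    exact ((hd t ht).1.sub (((o.dC (τ + t)).comp_const_add τ t).const_mul ρ)).prodMk
      ((hd t ht).2.sub (((o.dS (τ + t)).comp_const_add τ t).const_mul ρ))
  have key := norm_le_gronwallBound_of_norm_deriv_right_le
    (f := fun t => (x t - ρ * C (τ + t), v t - ρ * S (τ + t))) (δ := 0) (K := 1 + (a + b)) (ε := F)
    (a := 0) (b := 2 * π)
    (fun t ht => (hw t ht).continuousAt.continuousWithinAt)
    (fun t ht => (hw t ⟨ht.1, ht.2.le⟩).hasDerivWithinAt) (by simp [hx0, hv0]) ?_ t ht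
  · have h2 := key.trans (hmono (show t - 0 ≤ 2 * π by linarith [ht.2]))
    rw [Prod.norm_def] at h2
    exact ⟨(le_max_left _ _).trans h2, (le_max_right _ _).trans h2⟩
  · intro t ht
    have h1 : ρ * -gg a b (C (τ + t)) = -gg a b (ρ * C (τ + t)) := by rw [gg_smul hρ]; ring
    rw [h1, Prod.norm_def, Prod.norm_def]
    simp only [Real.norm_eq_abs]
    set e := x t - ρ * C (τ + t) with he
    set w := v t - ρ * S (τ + t) with hw'
    have hm1 : |e| ≤ max |e| |w| := le_max_left _ _
    have hm2 : |w| ≤ max |e| |w| := le_max_right _ _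
    have hm0 : 0 ≤ max |e| |w| := (abs_nonneg e).trans hm1
    apply max_le
    · nlinarith
    · have e1 : f t - gg a b (x t) - -gg a b (ρ * C (τ + t))
        = f t - (gg a b (x t) - gg a b (ρ * C (τ + t))) := by ring
      rw [e1]
      refine (abs_sub _ _).trans ?_
      have h2 := gg_lip ha hb (x t) (ρ * C (τ + t))
      have h3 := hf t ⟨ht.1, ht.2.le⟩
      rw [← he] at h2
      nlinarith

lemma hasDerivAt_J (o : Osc a b B C S) {p : ℝ → ℝ} (hp : Continuous p) (τ : ℝ) :
    HasDerivAt (fun τ => ∫ t in (0 : ℝ)..(2 * π), C (τ + t) * p t)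
      (∫ t in (0 : ℝ)..(2 * π), S (τ + t) * p t) τ := by
  have hC := o.cC
  have hS := o.cS
  refine (intervalIntegral.hasDerivAt_integral_of_dominated_loc_of_deriv_le
    (F := fun τ t => C (τ + t) * p t) (F' := fun τ t => S (τ + t) * p t)
    (bound := fun t => B * |p t|) (s := Set.univ) univ_mem ?_ ?_ ?_ ?_ ?_ ?_).2
  · exact Eventually.of_forall fun x => Continuous.aestronglyMeasurable (by fun_prop)
  · exact Continuous.intervalIntegrable (by fun_prop) _ _
  · exact Continuous.aestronglyMeasurable (by fun_prop)
  · refine Eventually.of_forall fun t _ x _ => ?_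
    rw [Real.norm_eq_abs, abs_mul]
    exact mul_le_mul_of_nonneg_right (o.bS _) (abs_nonneg _)
  · exact Continuous.intervalIntegrable (by fun_prop) _ _
  · exact Eventually.of_forall fun t _ x _ => ((o.dC (x + t)).comp_add_const x t).mul_const _

lemma cont_J' (o : Osc a b B C S) {p : ℝ → ℝ} (hp : Continuous p) :
    Continuous (fun τ => ∫ t in (0 : ℝ)..(2 * π), S (τ + t) * p t) := by
  have hS := o.cS
  apply intervalIntegral.continuous_parametric_intervalIntegral_of_continuous'
  unfold Function.uncurry
  fun_prop

end Osc

lemma int_lower {G G' k h : ℝ → ℝ} {c1 c2 : ℝ}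
    (hG : ∀ t ∈ Set.Icc 0 (2 * π), HasDerivAt G (G' t) t)
    (hG' : ContinuousOn G' (Set.Icc 0 (2 * π))) (hk : Continuous k)
    (hh : ContinuousOn h (Set.Icc 0 (2 * π)))
    (hle : ∀ t ∈ Set.Icc 0 (2 * π), k t - c1 * |h t| - c2 ≤ G' t) :
    (∫ t in (0 : ℝ)..(2 * π), k t) - c1 * (∫ t in (0 : ℝ)..(2 * π), |h t|) - c2 * (2 * π)
      ≤ G (2 * π) - G 0 := by
  have hpi : (0 : ℝ) ≤ 2 * π := by positivity
  have i1 : IntervalIntegrable G' volume 0 (2 * π) :=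
    ContinuousOn.intervalIntegrable (by rwa [Set.uIcc_of_le hpi])
  have i2 : IntervalIntegrable (fun t => |h t|) volume 0 (2 * π) :=
    ContinuousOn.intervalIntegrable (by rw [Set.uIcc_of_le hpi]; exact hh.abs)
  have i3 : IntervalIntegrable k volume 0 (2 * π) := hk.intervalIntegrable _ _
  rw [← intervalIntegral.integral_eq_sub_of_hasDerivAt (by rwa [Set.uIcc_of_le hpi]) i1]
  have i4 := i3.sub (i2.const_mul c1)
  have i5 : IntervalIntegrable (fun _ : ℝ => c2) volume 0 (2 * π) := intervalIntegrable_const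
  have := intervalIntegral.integral_mono_on hpi (i4.sub i5) i1 hle
  rw [intervalIntegral.integral_sub i4 i5, intervalIntegral.integral_sub i3 (i2.const_mul c1),
    intervalIntegral.integral_const_mul, intervalIntegral.integral_const] at this
  simp only [smul_eq_mul] at this
  linarith

namespace Osc

variable {a b B : ℝ} {C S : ℝ → ℝ}

set_option maxHeartbeats 1000000 in
/-- One period of a forced oscillator started in the trapping cone. -/
lemma step (o : Osc a b B C S) {p : ℝ → ℝ} (hp : Continuous p) {τs : ℝ}
    (hJ : ∫ t in (0 : ℝ)..(2 * π), C (τs + t) * p t = 0)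
    (hJ' : 0 < ∫ t in (0 : ℝ)..(2 * π), S (τs + t) * p t) :
    ∃ δ > 0, ∃ κ > 0, ∀ F ≥ 0, ∃ R > 0, ∃ K ≥ 0, ∀ (h x v : ℝ → ℝ) (ρ τ : ℝ), R ≤ ρ →
      |τ - τs| ≤ δ →
      (∀ t ∈ Set.Icc 0 (2 * π), HasDerivAt x (v t) t ∧
        HasDerivAt v (p t - h t - gg a b (x t)) t) →
      ContinuousOn h (Set.Icc 0 (2 * π)) →
      (∀ t ∈ Set.Icc 0 (2 * π), |p t - h t| ≤ F) → x 0 = ρ * C τ → v 0 = ρ * S τ →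
      (∀ t ∈ Set.Icc 0 (2 * π), |x t - ρ * C (τ + t)| ≤ K ∧ |v t - ρ * S (τ + t)| ≤ K) ∧
      ((∫ t in (0 : ℝ)..(2 * π), |h t|) ≤ κ → ∃ ρ' τ', |τ' - τs| ≤ δ ∧ 0 < ρ' ∧
        ρ ^ 2 + 1 ≤ ρ' ^ 2 ∧ x (2 * π) = ρ' * C τ' ∧ v (2 * π) = ρ' * S τ') := by
  have ha := o.ha
  have hb := o.hb
  have hB := o.hB
  have hC := o.cC
  have hS := o.cS
  have hpi := Real.pi_pos
  obtain ⟨δ₀, hδ₀, hD⟩ := o.exists_delta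
  set J : ℝ → ℝ := fun τ => ∫ t in (0 : ℝ)..(2 * π), C (τ + t) * p t with hJdef
  set J' : ℝ → ℝ := fun τ => ∫ t in (0 : ℝ)..(2 * π), S (τ + t) * p t with hJ'def
  have hdJ : ∀ τ, HasDerivAt J (J' τ) τ := fun τ => o.hasDerivAt_J hp τ
  have hcJ' : Continuous J' := o.cont_J' hp
  have hJ0 : J τs = 0 := hJ
  set d := J' τs with hd
  have hdpos : 0 < d := hJ'
  obtain ⟨δ₁, hδ₁, hδ₁'⟩ := Metric.continuousAt_iff.1 (hcJ'.continuousAt (x := τs)) (d / 2)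
    (by linarith)
  obtain ⟨δ, hδ, hδa, hδb⟩ : ∃ δ > 0, δ ≤ δ₀ ∧ δ < δ₁ :=
    ⟨min δ₀ (δ₁ / 2), by positivity, min_le_left _ _,
      (min_le_right _ _).trans_lt (by linarith)⟩
  have hJ'low : ∀ τ, |τ - τs| ≤ δ → d / 2 ≤ J' τ := by
    intro τ hτ
    have := hδ₁' (x := τ) (by rw [Real.dist_eq]; linarith)
    rw [Real.dist_eq] at this
    linarith [(abs_lt.1 this).1]
  have hmvt : ∀ x ∈ Set.Icc (τs - δ) (τs + δ), ∀ y ∈ Set.Icc (τs - δ) (τs + δ), x ≤ y →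
      d / 2 * (y - x) ≤ J y - J x :=
    Convex.mul_sub_le_image_sub_of_le_deriv (convex_Icc _ _)
      (fun s _ => (hdJ s).continuousAt.continuousWithinAt)
      (fun s _ => (hdJ s).differentiableAt.differentiableWithinAt) (by
        intro s hs
        have hs := interior_subset hs
        rw [(hdJ s).deriv]
        exact hJ'low s (by rw [abs_le]; constructor <;> linarith [hs.1, hs.2]))
  refine ⟨δ, hδ, min (d / 4) (d * δ / 8) / B, by positivity, ?_⟩
  intro F hF
  obtain ⟨K, hK, hgr⟩ := o.gron hF
  obtain ⟨Rp, hRp, hpol⟩ := o.polar hD (ε := δ / 2) (K := K) (by linarith) (by linarith) hK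
  refine ⟨Rp + 2 * (4 * π * K * F + a) / d + 16 * π * (a + b) * K ^ 2 / (d * δ) + 1,
    by positivity, K, hK, ?_⟩
  intro h x v ρ τ hρ hτ hdyn hh hF' hx0 hv0
  have q1 : 0 ≤ 2 * (4 * π * K * F + a) / d := by positivity
  have q2 : 0 ≤ 16 * π * (a + b) * K ^ 2 / (d * δ) := by positivity
  have hρ0 : 0 < ρ := by linarith
  have r1 : 2 * (4 * π * K * F + a) ≤ ρ * d := by
    rw [← div_le_iff₀ hdpos]; linarith
  have r2 : 16 * π * (a + b) * K ^ 2 < ρ * (d * δ) := by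
    rw [← div_lt_iff₀ (by positivity)]; linarith
  have hclose := hgr (fun t => p t - h t) x v ρ τ hρ0.le hdyn hF' hx0 hv0
  refine ⟨hclose, fun hκ => ?_⟩
  rw [le_div_iff₀ hB] at hκ
  set I := ∫ t in (0 : ℝ)..(2 * π), |h t| with hI
  have hκ1 : I * B ≤ d / 4 := hκ.trans (min_le_left _ _)
  have hκ2 : I * B ≤ d * δ / 8 := hκ.trans (min_le_right _ _)
  have cx : ContinuousOn x (Set.Icc 0 (2 * π)) := fun t ht =>
    (hdyn t ht).1.continuousAt.continuousWithinAt
  have cv : ContinuousOn v (Set.Icc 0 (2 * π)) := fun t ht =>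
    (hdyn t ht).2.continuousAt.continuousWithinAt
  have hmem : (2 * π) ∈ Set.Icc 0 (2 * π) := ⟨by linarith, le_rfl⟩
  -- the new polar coordinates
  obtain ⟨hxe, hve⟩ := hclose _ hmem
  rw [o.pC] at hxe
  rw [o.pS] at hve
  obtain ⟨ρ', hρ', τ', hτ', -, hx', hv'⟩ := hpol ρ (by linarith) τ _ _ hxe hve
  -- energy
  have henergy : 2 * ρ * J' τ - 2 * ρ * B * I - 2 * K * F * (2 * π) ≤
      (v (2 * π) ^ 2 + qq a b (x (2 * π))) - (v 0 ^ 2 + qq a b (x 0)) := by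
    have h1 := int_lower (G := fun t => v t ^ 2 + qq a b (x t))
      (G' := fun t => 2 * v t * (p t - h t)) (k := fun t => 2 * ρ * (S (τ + t) * p t))
      (h := h) (c1 := 2 * ρ * B) (c2 := 2 * K * F) ?_ ?_ ?_ hh ?_
    · rw [intervalIntegral.integral_const_mul] at h1
      exact h1
    · intro t ht
      have h5 := ((hdyn t ht).2.pow 2).add ((hasDerivAt_qq a b (x t)).comp t (hdyn t ht).1)
      refine h5.congr_deriv ?_
      simp; ring
    · have := hp.continuousOn (s := Set.Icc 0 (2 * π))
      fun_prop
    · fun_prop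
    · intro t ht
      have e : 2 * v t * (p t - h t) = 2 * ρ * (S (τ + t) * p t) - 2 * ρ * (S (τ + t) * h t)
          + 2 * ((v t - ρ * S (τ + t)) * (p t - h t)) := by ring
      rw [e]
      have h1 : |S (τ + t) * h t| ≤ B * |h t| := by
        rw [abs_mul]; exact mul_le_mul_of_nonneg_right (o.bS _) (abs_nonneg _)
      have h2 : |(v t - ρ * S (τ + t)) * (p t - h t)| ≤ K * F := by
        rw [abs_mul]; exact mul_le_mul (hclose t ht).2 (hF' t ht) (abs_nonneg _) hK
      have h3 := mul_le_mul_of_nonneg_left (abs_le.1 h1).2 hρ0.le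
      have h4 := (abs_le.1 h2).1
      nlinarith
  have hW : ∀ t ∈ Set.Icc 0 (2 * π), HasDerivAt
      (fun t => v t * (ρ * C (τ + t)) - x t * (ρ * S (τ + t)))
      ((p t - h t) * (ρ * C (τ + t)) +
        (x t * gg a b (ρ * C (τ + t)) - gg a b (x t) * (ρ * C (τ + t)))) t := by
    intro t ht
    have h5 := ((hdyn t ht).2.mul (((o.dC (τ + t)).comp_const_add τ t).const_mul ρ)).sub
      ((hdyn t ht).1.mul (((o.dS (τ + t)).comp_const_add τ t).const_mul ρ))
    refine h5.congr_deriv ?_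
    rw [gg_smul hρ0.le]; ring
  have hWc : ContinuousOn (fun t => (p t - h t) * (ρ * C (τ + t)) +
        (x t * gg a b (ρ * C (τ + t)) - gg a b (x t) * (ρ * C (τ + t)))) (Set.Icc 0 (2 * π)) := by
    have := hp.continuousOn (s := Set.Icc 0 (2 * π))
    have h1 : ContinuousOn (fun t => gg a b (x t)) (Set.Icc 0 (2 * π)) :=
      (gg_cont a b).comp_continuousOn cx
    have h2 : Continuous (fun t => gg a b (ρ * C (τ + t))) :=
      (gg_cont a b).comp (by fun_prop)
    have h3 := h2.continuousOn (s := Set.Icc 0 (2 * π))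
    fun_prop
  have hWest : ∀ t ∈ Set.Icc 0 (2 * π), |(p t - h t) * (ρ * C (τ + t)) +
        (x t * gg a b (ρ * C (τ + t)) - gg a b (x t) * (ρ * C (τ + t)))
        - ρ * (C (τ + t) * p t)| ≤ ρ * B * |h t| + (a + b) * K ^ 2 := by
    intro t ht
    have e : (p t - h t) * (ρ * C (τ + t)) +
        (x t * gg a b (ρ * C (τ + t)) - gg a b (x t) * (ρ * C (τ + t)))
        - ρ * (C (τ + t) * p t) = ρ * (-(C (τ + t) * h t)) +
        (x t * gg a b (ρ * C (τ + t)) - gg a b (x t) * (ρ * C (τ + t))) := by ring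
    rw [e]
    refine (abs_add_le _ _).trans ?_
    apply add_le_add
    · rw [abs_mul, abs_of_pos hρ0, abs_neg, abs_mul, mul_assoc]
      exact mul_le_mul_of_nonneg_left
        (mul_le_mul_of_nonneg_right (o.bC _) (abs_nonneg _)) hρ0.le
    · refine (gg_cross ha hb _ _).trans ?_
      have : (x t - ρ * C (τ + t)) ^ 2 ≤ K ^ 2 := sq_le_sq' (by
        linarith [(abs_le.1 (hclose t ht).1).1]) (abs_le.1 (hclose t ht).1).2
      exact mul_le_mul_of_nonneg_left this (by linarith)
  have hWlow : ρ * J τ - ρ * B * I - (a + b) * K ^ 2 * (2 * π) ≤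
      ρ * ρ' * (C τ * S τ' - S τ * C τ') := by
    have h1 := int_lower (k := fun t => ρ * (C (τ + t) * p t)) (h := h) (c1 := ρ * B)
      (c2 := (a + b) * K ^ 2) hW hWc (by fun_prop) hh (fun t ht => by
        have := (abs_le.1 (hWest t ht)).1
        linarith)
    rw [intervalIntegral.integral_const_mul] at h1
    refine h1.trans_eq ?_
    simp only [o.pC, o.pS, add_zero]
    rw [hx', hv', hx0, hv0]; ring
  have hWup : ρ * ρ' * (C τ * S τ' - S τ * C τ') ≤
      ρ * J τ + ρ * B * I + (a + b) * K ^ 2 * (2 * π) := by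
    have h1 := int_lower (k := fun t => -(ρ * (C (τ + t) * p t))) (h := h) (c1 := ρ * B)
      (c2 := (a + b) * K ^ 2) (fun t ht => (hW t ht).neg) hWc.neg (by fun_prop) hh (fun t ht => by
        have := (abs_le.1 (hWest t ht)).2
        linarith)
    rw [intervalIntegral.integral_neg, intervalIntegral.integral_const_mul] at h1
    simp only [Pi.neg_apply, o.pC, o.pS, add_zero] at h1
    rw [hx', hv', hx0, hv0] at h1
    have h2 : ρ * ∫ t in (0 : ℝ)..(2 * π), C (τ + t) * p t = ρ * J τ := rfl
    rw [h2] at h1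
    linarith
  refine ⟨ρ', τ', ?_, hρ', ?_, hx', hv'⟩
  · have hρρ : 0 < ρ * ρ' := by positivity
    obtain ⟨t1, t2⟩ := abs_le.1 hτ
    obtain ⟨t3, t4⟩ := abs_le.1 hτ'
    rw [abs_le]
    constructor
    · by_contra! hlt
      -- then the phase must have increased
      have c1 : τ ≤ τs - δ / 2 := by linarith
      have c2 := hmvt τ ⟨by linarith, by linarith⟩ τs ⟨by linarith, by linarith⟩ (by linarith)
      have m1 := mul_le_mul_of_nonneg_left (show δ / 2 ≤ τs - τ by linarith)
        (show 0 ≤ d / 2 by linarith)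
      have c3 : J τ ≤ -(d * δ / 4) := by linarith
      have c4 := o.cross_le hD (τ := τ') (σ := τ) (by linarith) (by linarith)
      have m2 := mul_pos (show 0 < a / 2 by linarith) (show 0 < τ - τ' by linarith)
      have c5 : 0 < C τ * S τ' - S τ * C τ' := by linarith
      have c6 := mul_pos hρρ c5
      have m3 := mul_le_mul_of_nonneg_left c3 hρ0.le
      have m4 := mul_le_mul_of_nonneg_left hκ2 hρ0.le
      linarith
    · by_contra! hlt
      have c1 : τs + δ / 2 ≤ τ := by linarith
      have c2 := hmvt τs ⟨by linarith, by linarith⟩ τ ⟨by linarith, by linarith⟩ (by linarith)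
      have m1 := mul_le_mul_of_nonneg_left (show δ / 2 ≤ τ - τs by linarith)
        (show 0 ≤ d / 2 by linarith)
      have c3 : d * δ / 4 ≤ J τ := by linarith
      have c4 := o.cross_le hD (τ := τ) (σ := τ') (by linarith) (by linarith)
      have m2 := mul_pos (show 0 < a / 2 by linarith) (show 0 < τ' - τ by linarith)
      have c5 : C τ * S τ' - S τ * C τ' < 0 := by linarith
      have c6 := mul_neg_of_pos_of_neg hρρ c5
      have m3 := mul_le_mul_of_nonneg_left c3 hρ0.le
      have m4 := mul_le_mul_of_nonneg_left hκ2 hρ0.le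
      linarith
  · have hJl := hJ'low τ hτ
    rw [hx', hv', hx0, hv0, qq_smul hρ'.le, qq_smul hρ0.le] at henergy
    have e1 := o.en τ
    have e2 := o.en τ'
    have e3 : ((ρ' * S τ') ^ 2 + ρ' ^ 2 * qq a b (C τ')) - ((ρ * S τ) ^ 2 + ρ ^ 2 * qq a b (C τ))
      = a * ρ' ^ 2 - a * ρ ^ 2 := by linear_combination ρ' ^ 2 * e2 - ρ ^ 2 * e1
    rw [e3] at henergy
    have h1 := mul_le_mul_of_nonneg_left hκ1 hρ0.le
    have h2 := mul_le_mul_of_nonneg_left hJl hρ0.le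
    have h3 : a * (ρ ^ 2 + 1) ≤ a * ρ' ^ 2 := by linarith
    exact le_of_mul_le_mul_left h3 ha

lemma zeros_finite (o : Osc a b B C S) : {t ∈ Set.Icc 0 (2 * π) | C t = 0}.Finite := by
  by_contra hinf
  obtain ⟨t, -, hacc⟩ := Set.Infinite.exists_accPt_of_subset_isCompact hinf isCompact_Icc
    (fun t ht => ht.1)
  rw [accPt_iff_frequently_nhdsNE] at hacc
  refine hacc ?_
  by_cases h0 : C t = 0
  · have hs : S t ≠ 0 := by
      intro hs
      have := o.en t
      rw [hs, h0] at this
      simp [qq] at this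
      exact o.ha.ne this
    filter_upwards [(o.dC t).eventually_ne (c := 0) hs] with z hz h using hz h.2
  · have := (o.cC.continuousAt (x := t)).eventually_ne h0
    filter_upwards [this.filter_mono nhdsWithin_le_nhds] with z hz h using hz h.2

lemma coupling (o : Osc a b B C S) {φ : ℝ → ℝ} (hφ : Continuous φ) {M c R₁ K κ : ℝ}
    (hM : ∀ x, |φ x| ≤ M) (hR₁ : 0 < R₁) (hc : ∀ x, R₁ ≤ |x| → |φ x| ≤ c) (hK : 0 ≤ K)
    (hc0 : 0 ≤ c) (hκ : 0 < κ) (hcκ : 2 * π * c ≤ κ / 2) :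
    ∃ R, ∀ ρ ≥ R, ∀ (τ : ℝ) (x : ℝ → ℝ), ContinuousOn x (Set.Icc 0 (2 * π)) →
      (∀ t ∈ Set.Icc 0 (2 * π), |x t - ρ * C (τ + t)| ≤ K) →
      ∫ t in (0 : ℝ)..(2 * π), |φ (x t)| ≤ κ := by
  have hC := o.cC
  have hpi : (0 : ℝ) ≤ 2 * π := by positivity
  have hM0 : 0 ≤ M := (abs_nonneg _).trans (hM 0)
  set D := R₁ + K with hDdef
  have hD : 0 < D := by linarith
  set ψ : ℝ → ℝ → ℝ := fun ρ u => max 0 (2 - ρ * |u| / D) with hψ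
  have hψc : ∀ ρ, Continuous (ψ ρ) := by intro ρ; simp only [hψ]; fun_prop
  have hlim : Tendsto (fun ρ => ∫ t in (0 : ℝ)..(2 * π), ψ ρ (C t)) atTop (nhds 0) := by
    have h := intervalIntegral.tendsto_integral_filter_of_dominated_convergence
      (F := fun ρ t => ψ ρ (C t)) (f := fun _ => (0 : ℝ)) (l := atTop) (μ := volume)
      (a := 0) (b := 2 * π) (fun _ => (2 : ℝ)) ?_ ?_ ?_ ?_
    · simpa using h
    · exact Eventually.of_forall fun ρ => ((hψc ρ).comp hC).aestronglyMeasurable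
    · filter_upwards [eventually_ge_atTop 0] with ρ hρ
      refine Eventually.of_forall fun t _ => ?_
      rw [Real.norm_eq_abs, abs_of_nonneg (le_max_left _ _)]
      apply max_le (by norm_num)
      have : 0 ≤ ρ * |C t| / D := by positivity
      linarith
    · exact intervalIntegrable_const
    · have hz : volume {t ∈ Set.Icc 0 (2 * π) | C t = 0} = 0 := o.zeros_finite.measure_zero _
      have hz' := measure_eq_zero_iff_ae_notMem.1 hz
      filter_upwards [hz'] with t ht hmem
      rw [Set.uIoc_of_le hpi] at hmem
      have hCt : C t ≠ 0 := fun h0 => ht ⟨⟨hmem.1.le, hmem.2⟩, h0⟩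
      have hpos : 0 < |C t| := abs_pos.2 hCt
      refine tendsto_const_nhds.congr' ?_
      filter_upwards [eventually_ge_atTop (2 * D / |C t|)] with ρ hρ
      rw [div_le_iff₀ hpos] at hρ
      symm
      apply max_eq_left
      have : 2 ≤ ρ * |C t| / D := by rw [le_div_iff₀ hD]; exact hρ
      linarith
  have hev : ∀ᶠ ρ in atTop, M * (∫ t in (0 : ℝ)..(2 * π), ψ ρ (C t)) < κ / 2 := by
    have := hlim.const_mul M
    rw [mul_zero] at this
    exact this.eventually (gt_mem_nhds (by linarith))
  obtain ⟨R, hR⟩ := eventually_atTop.1 hev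
  refine ⟨max R 0, fun ρ hρ τ x hx hcl => ?_⟩
  have hρR : R ≤ ρ := (le_max_left _ _).trans hρ
  have hρ0 : 0 ≤ ρ := (le_max_right _ _).trans hρ
  have hshift : ∫ t in (0 : ℝ)..(2 * π), ψ ρ (C (τ + t)) = ∫ t in (0 : ℝ)..(2 * π), ψ ρ (C t) := by
    rw [intervalIntegral.integral_comp_add_left (fun t => ψ ρ (C t)) τ, add_zero]
    have hper : Function.Periodic (fun t => ψ ρ (C t)) (2 * π) := by
      intro t; simp only [o.pC]
    have := hper.intervalIntegral_add_eq τ 0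
    rwa [zero_add] at this
  have hcψ : Continuous (fun t => ψ ρ (C (τ + t))) := (hψc ρ).comp (by fun_prop)
  have hpt : ∀ t ∈ Set.Icc 0 (2 * π), |φ (x t)| ≤ c + M * ψ ρ (C (τ + t)) := by
    intro t ht
    rcases le_or_gt R₁ |x t| with h | h
    · have h1 : 0 ≤ ψ ρ (C (τ + t)) := le_max_left _ _
      have := hc _ h
      nlinarith [mul_nonneg hM0 h1]
    · have h1 : 1 ≤ ψ ρ (C (τ + t)) := by
        refine le_trans ?_ (le_max_right _ _)
        have h2 : |ρ * C (τ + t)| ≤ D := by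
          have e : ρ * C (τ + t) = x t - (x t - ρ * C (τ + t)) := by ring
          rw [e]
          refine (abs_sub _ _).trans ?_
          linarith [hcl t ht]
        rw [abs_mul, abs_of_nonneg hρ0] at h2
        have : ρ * |C (τ + t)| / D ≤ 1 := by rw [div_le_one hD]; exact h2
        linarith
      have := hM (x t)
      nlinarith
  have hint := intervalIntegral.integral_mono_on (μ := volume) hpi
    (f := fun t => |φ (x t)|) (g := fun t => c + M * ψ ρ (C (τ + t)))
    (ContinuousOn.intervalIntegrable (by
      rw [Set.uIcc_of_le hpi]; exact (hφ.comp_continuousOn hx).abs))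
    (Continuous.intervalIntegrable (by fun_prop) _ _) hpt
  refine hint.trans ?_
  rw [intervalIntegral.integral_add intervalIntegrable_const
    (Continuous.intervalIntegrable (by fun_prop) _ _), intervalIntegral.integral_const,
    intervalIntegral.integral_const_mul, hshift]
  have := hR ρ hρR
  simp only [smul_eq_mul, sub_zero]
  linarith

end Osc

def InCone (C S : ℝ → ℝ) (R δ τs x v : ℝ) : Prop :=
  ∃ ρ τ, R ≤ ρ ∧ |τ - τs| ≤ δ ∧ x = ρ * C τ ∧ v = ρ * S τ

lemma InCone.two {C S : ℝ → ℝ} {R δ τs x v : ℝ} (hR : 0 ≤ R) (h : InCone C S R δ τs x v) :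
    InCone C S R δ τs (2 * x) (2 * v) := by
  obtain ⟨ρ, τ, h1, h2, rfl, rfl⟩ := h
  exact ⟨2 * ρ, τ, by linarith, h2, by ring, by ring⟩

lemma Osc.cone_ball {a b B : ℝ} {C S : ℝ → ℝ} (o : Osc a b B C S) {δ : ℝ} (hδ : 0 < δ)
    (R τs : ℝ) : ∃ x0 v0, ∀ x v, |x - x0| ≤ 1 → |v - v0| ≤ 1 → InCone C S R δ τs x v := by
  obtain ⟨δ₀, hδ₀, hD⟩ := o.exists_delta
  obtain ⟨Rp, -, hpol⟩ := o.polar hD (ε := min δ δ₀) (K := 1) (by positivity)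
    (min_le_right _ _) zero_le_one
  refine ⟨max Rp (4 * R) * C τs, max Rp (4 * R) * S τs, fun x v hx hv => ?_⟩
  obtain ⟨ρ', -, τ', h1, h2, h3, h4⟩ := hpol _ (le_max_left _ _) τs x v hx hv
  refine ⟨ρ', τ', ?_, h1.trans (min_le_left _ _), h3, h4⟩
  have := le_max_right Rp (4 * R)
  linarith

lemma volume_top {E : Set (ℝ × ℝ × ℝ × ℝ)} (h2 : ∀ z ∈ E, (2 : ℝ) • z ∈ E)
    (hne : (interior E).Nonempty) : volume (interior E) = ⊤ := by
  haveI : (volume : Measure (ℝ × ℝ)).IsAddHaarMeasure :=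
    inferInstanceAs ((volume : Measure ℝ).prod (volume : Measure ℝ)).IsAddHaarMeasure
  haveI : (volume : Measure (ℝ × ℝ × ℝ)).IsAddHaarMeasure :=
    inferInstanceAs ((volume : Measure ℝ).prod (volume : Measure (ℝ × ℝ))).IsAddHaarMeasure
  haveI : (volume : Measure (ℝ × ℝ × ℝ × ℝ)).IsAddHaarMeasure :=
    inferInstanceAs ((volume : Measure ℝ).prod (volume : Measure (ℝ × ℝ × ℝ))).IsAddHaarMeasure
  have hpos : 0 < volume (interior E) := isOpen_interior.measure_pos _ hne
  have hsub : (fun z => (2 : ℝ) • z) '' interior E ⊆ interior E := by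
    have hop : IsOpen ((fun z => (2 : ℝ) • z) '' interior E) :=
      (isOpenMap_smul₀ (two_ne_zero : (2 : ℝ) ≠ 0)) _ isOpen_interior
    apply interior_maximal _ hop
    rintro _ ⟨z, hz, rfl⟩
    exact h2 z (interior_subset hz)
  have h3 := measure_mono (μ := volume) hsub
  rw [Set.image_smul, Measure.addHaar_smul] at h3
  by_contra hfin
  have hfr : Module.finrank ℝ (ℝ × ℝ × ℝ × ℝ) = 4 := by simp
  rw [hfr] at h3
  have h4 : volume (interior E) < ENNReal.ofReal |(2 : ℝ) ^ 4| * volume (interior E) := by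
    have h5 : (1 : ENNReal) < ENNReal.ofReal |(2 : ℝ) ^ 4| := by
      rw [ENNReal.one_lt_ofReal]; norm_num
    calc volume (interior E) = 1 * volume (interior E) := (one_mul _).symm
      _ < _ := ENNReal.mul_lt_mul_left hpos.ne' hfin h5
  exact absurd h3 (not_le.2 h4)

lemma Osc.low {a b B : ℝ} {C S : ℝ → ℝ} (o : Osc a b B C S) {ρ τ K x v : ℝ}
    (hx : |x - ρ * C τ| ≤ K) (hv : |v - ρ * S τ| ≤ K) :
    (a * ρ ^ 2 / (1 + a + b) - 4 * K ^ 2) / 2 ≤ x ^ 2 + v ^ 2 := by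
  have ha := o.ha
  have hb := o.hb
  have h1 : a ≤ (1 + a + b) * (C τ ^ 2 + S τ ^ 2) := by
    have := o.en τ
    have h2 : qq a b (C τ) ≤ (a + b) * C τ ^ 2 := by
      rcases le_total 0 (C τ) with h | h
      · rw [qq_of_nonneg h]; nlinarith [sq_nonneg (C τ)]
      · rw [qq_of_nonpos h]; nlinarith [sq_nonneg (C τ)]
    nlinarith [sq_nonneg (C τ), sq_nonneg (S τ)]
  have h2 : a * ρ ^ 2 / (1 + a + b) ≤ (ρ * C τ) ^ 2 + (ρ * S τ) ^ 2 := by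
    rw [div_le_iff₀ (by linarith)]
    have := mul_le_mul_of_nonneg_right h1 (sq_nonneg ρ)
    linarith
  have h3 : (x - ρ * C τ) ^ 2 ≤ K ^ 2 := sq_le_sq' (by linarith [(abs_le.1 hx).1]) (abs_le.1 hx).2
  have h4 : (v - ρ * S τ) ^ 2 ≤ K ^ 2 := sq_le_sq' (by linarith [(abs_le.1 hv).1]) (abs_le.1 hv).2
  have h5 : (ρ * C τ) ^ 2 ≤ 2 * x ^ 2 + 2 * (x - ρ * C τ) ^ 2 := by
    linarith [sq_nonneg (2 * x - ρ * C τ)]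
  have h6 : (ρ * S τ) ^ 2 ≤ 2 * v ^ 2 + 2 * (v - ρ * S τ) ^ 2 := by
    linarith [sq_nonneg (2 * v - ρ * S τ)]
  linarith

lemma Osc.tendsto {a b B : ℝ} {C S : ℝ → ℝ} (o : Osc a b B C S) {K : ℝ} {x v : ℝ → ℝ}
    (h : ∀ k : ℕ, ∃ ρ τ : ℝ, (k : ℝ) ≤ ρ ^ 2 ∧ ∀ t ∈ Set.Icc 0 (2 * π),
      |x (t + k * (2 * π)) - ρ * C (τ + t)| ≤ K ∧ |v (t + k * (2 * π)) - ρ * S (τ + t)| ≤ K) :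
    Tendsto (fun t => x t ^ 2 + v t ^ 2) atTop atTop := by
  have ha := o.ha
  have hb := o.hb
  have hpi : 0 < 2 * π := by positivity
  have hg : Tendsto (fun t : ℝ => (a * (t / (2 * π) - 1) / (1 + a + b) - 4 * K ^ 2) / 2)
      atTop atTop := by
    apply Tendsto.atTop_div_const (by norm_num)
    apply tendsto_atTop_add_const_right _ (-(4 * K ^ 2))
    apply Tendsto.atTop_div_const (by linarith)
    apply Tendsto.const_mul_atTop ha
    apply tendsto_atTop_add_const_right _ (-1)
    exact Tendsto.atTop_div_const hpi tendsto_id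
  refine tendsto_atTop_mono' _ ?_ hg
  filter_upwards [eventually_ge_atTop 0] with t ht
  obtain ⟨ρ, τ, h1, h2⟩ := h ⌊t / (2 * π)⌋₊
  have h3 := Nat.floor_le (div_nonneg ht hpi.le)
  have h4 := Nat.lt_floor_add_one (t / (2 * π))
  set k : ℝ := (⌊t / (2 * π)⌋₊ : ℝ) with hk
  rw [le_div_iff₀ hpi] at h3
  have h4' := h4
  rw [div_lt_iff₀ hpi] at h4'
  have h5 := h2 (t - k * (2 * π)) ⟨by linarith, by linarith⟩
  rw [sub_add_cancel] at h5
  refine le_trans ?_ (o.low h5.1 h5.2)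
  have h6 : a * (t / (2 * π) - 1) ≤ a * ρ ^ 2 := mul_le_mul_of_nonneg_left (by linarith) ha.le
  have h7 := div_le_div_of_nonneg_right h6 (show 0 ≤ 1 + a + b by linarith)
  linarith

lemma far_bound {φ : ℝ → ℝ} {l c : ℝ} (h1 : Tendsto φ atTop (nhds l))
    (h2 : Tendsto φ atBot (nhds (-l))) (hl : |l| < c) :
    ∃ R > 0, ∀ x, R ≤ |x| → |φ x| ≤ c := by
  have e1 := (h1.abs).eventually (gt_mem_nhds hl)
  have e2 := (h2.abs).eventually (gt_mem_nhds (by rwa [abs_neg]))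
  obtain ⟨R1, hR1⟩ := eventually_atTop.1 e1
  obtain ⟨R2, hR2⟩ := eventually_atBot.1 e2
  refine ⟨max (max R1 (-R2)) 1, by positivity, fun x hx => ?_⟩
  have h3 : R1 ≤ |x| := ((le_max_left _ _).trans (le_max_left _ _)).trans hx
  have h4 : -R2 ≤ |x| := ((le_max_right _ _).trans (le_max_left _ _)).trans hx
  rcases le_total 0 x with h | h
  · rw [abs_of_nonneg h] at h3; exact (hR1 x h3).le
  · rw [abs_of_nonpos h] at h4; exact (hR2 x (by linarith)).le

lemma per_bound {p : ℝ → ℝ} (hp : Continuous p) (hper : ∀ t, p (t + 2 * π) = p t) :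
    ∃ A ≥ 0, ∀ t, |p t| ≤ A := by
  obtain ⟨B, hB⟩ := (isCompact_Icc (a := (0 : ℝ)) (b := 2 * π)).exists_bound_of_continuousOn
    hp.continuousOn
  have hp' : Function.Periodic p (2 * π) := hper
  have key : ∀ t, |p t| ≤ B := by
    intro t
    obtain ⟨y, hy, e⟩ := hp'.exists_mem_Ico₀ (by positivity) t
    rw [e]; exact hB y ⟨hy.1, hy.2.le⟩
  exact ⟨B, (abs_nonneg _).trans (key 0), key⟩

lemma Osc.from_Phi {a b B : ℝ} {C S : ℝ → ℝ} (o : Osc a b B C S) {n : ℕ} (hn : 1 ≤ n) {γ : ℝ}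
    (hγ : γ = √(2 * n / a)) {p : ℝ → ℝ} (hp : Continuous p) {Φ : ℝ → ℝ}
    (hΦ : ∀ θ, Φ θ = -(γ / 2) * ∫ t in (0 : ℝ)..(2 * π), C (θ / n + t) * p t)
    {ω : ℝ} (hz : Φ ω = 0) (hz' : deriv Φ ω < 0) :
    (∫ t in (0 : ℝ)..(2 * π), C (ω / n + t) * p t = 0) ∧
      0 < ∫ t in (0 : ℝ)..(2 * π), S (ω / n + t) * p t := by
  have hn0 : (0 : ℝ) < n := by exact_mod_cast hn
  have hγ0 : 0 < γ := by
    rw [hγ]; have := o.ha; positivity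
  constructor
  · rw [hΦ] at hz
    rcases mul_eq_zero.1 hz with h | h
    · linarith
    · exact h
  · have h1 : HasDerivAt Φ (-(γ / 2) * ((∫ t in (0 : ℝ)..(2 * π), S (ω / n + t) * p t) *
        (1 / n))) ω := by
      have h2 := ((o.hasDerivAt_J hp (ω / n)).comp ω ((hasDerivAt_id ω).div_const (n : ℝ))).const_mul
        (-(γ / 2))
      have e : Φ = fun θ => -(γ / 2) * ∫ t in (0 : ℝ)..(2 * π), C (θ / n + t) * p t := funext hΦ
      rw [e]
      exact h2
    rw [h1.deriv] at hz'
    by_contra! hle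
    have h3 : (∫ t in (0 : ℝ)..(2 * π), S (ω / n + t) * p t) * (1 / n) ≤ 0 :=
      mul_nonpos_of_nonpos_of_nonneg hle (by positivity)
    nlinarith

theorem stmt13 (n : ℕ) (hn : 1 ≤ n)
    (a₁ b₁ a₂ b₂ : ℝ)
    (ha₁ : (n : ℝ) ^ 2 / 4 < a₁) (hb₁ : 0 < b₁)
    (ha₂ : (n : ℝ) ^ 2 / 4 < a₂) (hb₂ : 0 < b₂)
    (hres₁ : 1 / Real.sqrt a₁ + 1 / Real.sqrt b₁ = 2 / (n : ℝ))
    (hres₂ : 1 / Real.sqrt a₂ + 1 / Real.sqrt b₂ = 2 / (n : ℝ))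
    (C₁ C₂ : ℝ → ℝ) (hC₁ : IsAsymCos n a₁ b₁ C₁) (hC₂ : IsAsymCos n a₂ b₂ C₂)
    (γ₁ γ₂ α₁ α₂ : ℝ)
    (hγ₁ : γ₁ = Real.sqrt (2 * n / a₁)) (hγ₂ : γ₂ = Real.sqrt (2 * n / a₂))
    (hα₁ : α₁ = 1 / Real.sqrt a₁ - Real.sqrt a₁ / b₁)
    (hα₂ : α₂ = 1 / Real.sqrt a₂ - Real.sqrt a₂ / b₂)
    (K₁ K₂ : ℝ → ℝ)
    (hK₁ : ∀ t, K₁ t = ∫ s in (0 : ℝ)..t, C₁ s)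
    (hK₂ : ∀ t, K₂ t = ∫ s in (0 : ℝ)..t, C₂ s)
    (Λ₁ Λ₂ : ℝ → ℝ)
    (hΛ₁ : ∀ t, Λ₁ t = K₁ (t / n + π / (2 * Real.sqrt a₂)) - K₁ (t / n - π / (2 * Real.sqrt a₂)))
    (hΛ₂ : ∀ t, Λ₂ t = K₂ (t / n + π / (2 * Real.sqrt a₁)) - K₂ (t / n - π / (2 * Real.sqrt a₁)))
    (p₁ p₂ : ℝ → ℝ) (hp₁ : Continuous p₁) (hp₂ : Continuous p₂)
    (hp₁per : ∀ t, p₁ (t + 2 * π) = p₁ t) (hp₂per : ∀ t, p₂ (t + 2 * π) = p₂ t)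
    (Φ₁ Φ₂ : ℝ → ℝ)
    (hΦ₁ : ∀ θ, Φ₁ θ = -(γ₁ / 2) * ∫ t in (0 : ℝ)..(2 * π), C₁ (θ / n + t) * p₁ t)
    (hΦ₂ : ∀ θ, Φ₂ θ = -(γ₂ / 2) * ∫ t in (0 : ℝ)..(2 * π), C₂ (θ / n + t) * p₂ t)
    (ω₁s ω₂s : ℝ) (hz₁ : Φ₁ ω₁s = 0) (hz₂ : Φ₂ ω₂s = 0)
    (hz₁' : deriv Φ₁ ω₁s < 0) (hz₂' : deriv Φ₂ ω₂s < 0) :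
    ∃ φstar > (0 : ℝ), ∀ φ₁ φ₂ : ℝ → ℝ, ∀ φ₁inf φ₂inf : ℝ,
      LocallyLipschitz φ₁ → LocallyLipschitz φ₂ →
      (∃ M, ∀ x, |φ₁ x| ≤ M) → (∃ M, ∀ x, |φ₂ x| ≤ M) →
      Tendsto φ₁ atTop (nhds φ₁inf) → Tendsto φ₁ atBot (nhds (-φ₁inf)) →
      Tendsto φ₂ atTop (nhds φ₂inf) → Tendsto φ₂ atBot (nhds (-φ₂inf)) →
      |φ₁inf| < φstar → |φ₂inf| < φstar →
      ∃ E : Set (ℝ × ℝ × ℝ × ℝ), MeasurableSet E ∧ volume E = ⊤ ∧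
        ∀ x₁ x₂ v₁ v₂ : ℝ → ℝ,
        (∀ t ∈ Set.Ici (0 : ℝ),
          HasDerivAt x₁ (v₁ t) t ∧ HasDerivAt x₂ (v₂ t) t ∧
          HasDerivAt v₁ (p₁ t - a₁ * max (x₁ t) 0 + b₁ * max (-x₁ t) 0 - φ₁ (x₂ t)) t ∧
          HasDerivAt v₂ (p₂ t - a₂ * max (x₂ t) 0 + b₂ * max (-x₂ t) 0 - φ₂ (x₁ t)) t) →
        (x₁ 0, x₂ 0, v₁ 0, v₂ 0) ∈ E →
        (Tendsto (fun t => (x₁ t) ^ 2 + (v₁ t) ^ 2) atTop atTop ∧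
         Tendsto (fun t => (x₂ t) ^ 2 + (v₂ t) ^ 2) atTop atTop) := by
  have hn0 : (0 : ℝ) < n := by exact_mod_cast hn
  have hpi : 0 < 2 * π := by positivity
  have ha1 : 0 < a₁ := lt_of_le_of_lt (by positivity) ha₁
  have ha2 : 0 < a₂ := lt_of_le_of_lt (by positivity) ha₂
  obtain ⟨B₁, o₁⟩ := isAsymCos_osc hn ha1 hb₁ hres₁ hC₁
  obtain ⟨B₂, o₂⟩ := isAsymCos_osc hn ha2 hb₂ hres₂ hC₂
  set S₁ := deriv C₁
  set S₂ := deriv C₂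
  obtain ⟨hJ₁, hJ₁'⟩ := o₁.from_Phi hn hγ₁ hp₁ hΦ₁ hz₁ hz₁'
  obtain ⟨hJ₂, hJ₂'⟩ := o₂.from_Phi hn hγ₂ hp₂ hΦ₂ hz₂ hz₂'
  obtain ⟨δ₁, hδ₁, κ₁, hκ₁, step₁⟩ := o₁.step hp₁ hJ₁ hJ₁'
  obtain ⟨δ₂, hδ₂, κ₂, hκ₂, step₂⟩ := o₂.step hp₂ hJ₂ hJ₂'
  obtain ⟨A₁, hA₁, hpA₁⟩ := per_bound hp₁ hp₁per
  obtain ⟨A₂, hA₂, hpA₂⟩ := per_bound hp₂ hp₂per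
  have hs0 : 0 < min κ₁ κ₂ / (4 * π) := by positivity
  refine ⟨min κ₁ κ₂ / (4 * π), hs0, ?_⟩
  intro φ₁ φ₂ l₁ l₂ hL₁ hL₂ hM₁ hM₂ ht₁ hb₁' ht₂ hb₂' hl₁ hl₂
  have hsκ : 2 * π * (min κ₁ κ₂ / (4 * π)) = min κ₁ κ₂ / 2 := by field_simp; ring
  generalize min κ₁ κ₂ / (4 * π) = c at *
  have hcκ₁ : 2 * π * c ≤ κ₁ / 2 := by rw [hsκ]; linarith [min_le_left κ₁ κ₂]
  have hcκ₂ : 2 * π * c ≤ κ₂ / 2 := by rw [hsκ]; linarith [min_le_right κ₁ κ₂]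
  obtain ⟨M₁, hM₁⟩ := hM₁
  obtain ⟨M₂, hM₂⟩ := hM₂
  have hM₁0 : 0 ≤ M₁ := (abs_nonneg _).trans (hM₁ 0)
  have hM₂0 : 0 ≤ M₂ := (abs_nonneg _).trans (hM₂ 0)
  obtain ⟨r₁, hr₁, hfar₁⟩ := far_bound ht₁ hb₁' hl₁
  obtain ⟨r₂, hr₂, hfar₂⟩ := far_bound ht₂ hb₂' hl₂
  obtain ⟨R₁, hR₁, K₁', hK₁', st₁⟩ := step₁ (A₁ + M₁) (by linarith)
  obtain ⟨R₂, hR₂, K₂', hK₂', st₂⟩ := step₂ (A₂ + M₂) (by linarith)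
  obtain ⟨Q₁, hQ₁⟩ := o₂.coupling hL₁.continuous hM₁ hr₁ hfar₁ hK₂' hs0.le hκ₁ hcκ₁
  obtain ⟨Q₂, hQ₂⟩ := o₁.coupling hL₂.continuous hM₂ hr₂ hfar₂ hK₁' hs0.le hκ₂ hcκ₂
  obtain ⟨R, hRR₁, hRR₂, hRQ₁, hRQ₂⟩ : ∃ R, R₁ ≤ R ∧ R₂ ≤ R ∧ Q₁ ≤ R ∧ Q₂ ≤ R :=
    ⟨max (max R₁ R₂) (max Q₁ Q₂), (le_max_left _ _).trans (le_max_left _ _),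
      (le_max_right _ _).trans (le_max_left _ _), (le_max_left _ _).trans (le_max_right _ _),
      (le_max_right _ _).trans (le_max_right _ _)⟩
  have hR0 : 0 < R := by linarith
  set E₀ : Set (ℝ × ℝ × ℝ × ℝ) := {z | InCone C₁ S₁ R δ₁ (ω₁s / n) z.1 z.2.2.1 ∧
    InCone C₂ S₂ R δ₂ (ω₂s / n) z.2.1 z.2.2.2} with hE₀
  refine ⟨interior E₀, isOpen_interior.measurableSet, ?_, ?_⟩
  · apply volume_top
    · rintro ⟨x, y, u, w⟩ ⟨h1, h2⟩
      exact ⟨h1.two hR0.le, h2.two hR0.le⟩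
    · obtain ⟨x0, u0, h1⟩ := o₁.cone_ball hδ₁ R (ω₁s / n)
      obtain ⟨y0, w0, h2⟩ := o₂.cone_ball hδ₂ R (ω₂s / n)
      refine ⟨(x0, y0, u0, w0), mem_interior_iff_mem_nhds.2
        (mem_of_superset (Metric.closedBall_mem_nhds _ one_pos) ?_)⟩
      rintro ⟨x, y, u, w⟩ hz
      rw [Metric.mem_closedBall, Prod.dist_eq, Prod.dist_eq, Prod.dist_eq] at hz
      simp only [max_le_iff, Real.dist_eq] at hz
      exact ⟨h1 _ _ hz.1 hz.2.2.1, h2 _ _ hz.2.1 hz.2.2.2⟩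
  intro x₁ x₂ v₁ v₂ hsol hin
  have hstart := interior_subset hin
  -- one period
  have one : ∀ (k : ℕ) (ρ₁ τ₁ ρ₂ τ₂ : ℝ), R ≤ ρ₁ → R ≤ ρ₂ → |τ₁ - ω₁s / n| ≤ δ₁ →
      |τ₂ - ω₂s / n| ≤ δ₂ →
      x₁ (k * (2 * π)) = ρ₁ * C₁ τ₁ → v₁ (k * (2 * π)) = ρ₁ * S₁ τ₁ →
      x₂ (k * (2 * π)) = ρ₂ * C₂ τ₂ → v₂ (k * (2 * π)) = ρ₂ * S₂ τ₂ →
      (∀ t ∈ Set.Icc 0 (2 * π), |x₁ (t + k * (2 * π)) - ρ₁ * C₁ (τ₁ + t)| ≤ K₁' ∧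
        |v₁ (t + k * (2 * π)) - ρ₁ * S₁ (τ₁ + t)| ≤ K₁') ∧
      (∀ t ∈ Set.Icc 0 (2 * π), |x₂ (t + k * (2 * π)) - ρ₂ * C₂ (τ₂ + t)| ≤ K₂' ∧
        |v₂ (t + k * (2 * π)) - ρ₂ * S₂ (τ₂ + t)| ≤ K₂') ∧
      (∃ ρ' τ', |τ' - ω₁s / n| ≤ δ₁ ∧ 0 < ρ' ∧ ρ₁ ^ 2 + 1 ≤ ρ' ^ 2 ∧
        x₁ (2 * π + k * (2 * π)) = ρ' * C₁ τ' ∧ v₁ (2 * π + k * (2 * π)) = ρ' * S₁ τ') ∧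
      (∃ ρ' τ', |τ' - ω₂s / n| ≤ δ₂ ∧ 0 < ρ' ∧ ρ₂ ^ 2 + 1 ≤ ρ' ^ 2 ∧
        x₂ (2 * π + k * (2 * π)) = ρ' * C₂ τ' ∧ v₂ (2 * π + k * (2 * π)) = ρ' * S₂ τ') := by
    intro k ρ₁ τ₁ ρ₂ τ₂ hρ₁ hρ₂ hτ₁ hτ₂ hx₁ hv₁ hx₂ hv₂
    have hkp : (0 : ℝ) ≤ k * (2 * π) := by positivity
    have hper₁ : ∀ t, p₁ (t + k * (2 * π)) = p₁ t := fun t =>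
      (show Function.Periodic p₁ (2 * π) from hp₁per).nat_mul k t
    have hper₂ : ∀ t, p₂ (t + k * (2 * π)) = p₂ t := fun t =>
      (show Function.Periodic p₂ (2 * π) from hp₂per).nat_mul k t
    have hs : ∀ t ∈ Set.Icc 0 (2 * π), t + k * (2 * π) ∈ Set.Ici (0 : ℝ) := fun t ht =>
      Set.mem_Ici.2 (by linarith [ht.1])
    have dyn₁ : ∀ t ∈ Set.Icc 0 (2 * π),
        HasDerivAt (fun t => x₁ (t + k * (2 * π))) (v₁ (t + k * (2 * π))) t ∧
        HasDerivAt (fun t => v₁ (t + k * (2 * π))) (p₁ t - φ₁ (x₂ (t + k * (2 * π)))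
          - gg a₁ b₁ (x₁ (t + k * (2 * π)))) t := by
      intro t ht
      obtain ⟨d1, -, d3, -⟩ := hsol _ (hs t ht)
      refine ⟨d1.comp_add_const t _, (d3.comp_add_const t _).congr_deriv ?_⟩
      rw [hper₁]; unfold gg; ring
    have dyn₂ : ∀ t ∈ Set.Icc 0 (2 * π),
        HasDerivAt (fun t => x₂ (t + k * (2 * π))) (v₂ (t + k * (2 * π))) t ∧
        HasDerivAt (fun t => v₂ (t + k * (2 * π))) (p₂ t - φ₂ (x₁ (t + k * (2 * π)))
          - gg a₂ b₂ (x₂ (t + k * (2 * π)))) t := by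
      intro t ht
      obtain ⟨-, d2, -, d4⟩ := hsol _ (hs t ht)
      refine ⟨d2.comp_add_const t _, (d4.comp_add_const t _).congr_deriv ?_⟩
      rw [hper₂]; unfold gg; ring
    have cx₁ : ContinuousOn (fun t => x₁ (t + k * (2 * π))) (Set.Icc 0 (2 * π)) := fun t ht =>
      (dyn₁ t ht).1.continuousAt.continuousWithinAt
    have cx₂ : ContinuousOn (fun t => x₂ (t + k * (2 * π))) (Set.Icc 0 (2 * π)) := fun t ht =>
      (dyn₂ t ht).1.continuousAt.continuousWithinAt
    obtain ⟨cl₁, nx₁⟩ := st₁ (fun t => φ₁ (x₂ (t + k * (2 * π)))) _ _ ρ₁ τ₁ (by linarith) hτ₁ dyn₁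
      (hL₁.continuous.comp_continuousOn cx₂)
      (fun t _ => (abs_sub _ _).trans (add_le_add (hpA₁ _) (hM₁ _)))
      (by simpa using hx₁) (by simpa using hv₁)
    obtain ⟨cl₂, nx₂⟩ := st₂ (fun t => φ₂ (x₁ (t + k * (2 * π)))) _ _ ρ₂ τ₂ (by linarith) hτ₂ dyn₂
      (hL₂.continuous.comp_continuousOn cx₁)
      (fun t _ => (abs_sub _ _).trans (add_le_add (hpA₂ _) (hM₂ _)))
      (by simpa using hx₂) (by simpa using hv₂)
    exact ⟨cl₁, cl₂, nx₁ (hQ₁ ρ₂ (by linarith) τ₂ _ cx₂ fun t ht => (cl₂ t ht).1),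
      nx₂ (hQ₂ ρ₁ (by linarith) τ₁ _ cx₁ fun t ht => (cl₁ t ht).1)⟩
  have grow : ∀ ρ ρ' : ℝ, R ≤ ρ → 0 < ρ' → ρ ^ 2 + 1 ≤ ρ' ^ 2 → R ≤ ρ' := by
    intro ρ ρ' h1 h2 h3
    nlinarith
  have all : ∀ k : ℕ, ∃ ρ₁ τ₁ ρ₂ τ₂ : ℝ, (R ≤ ρ₁ ∧ R ≤ ρ₂ ∧ |τ₁ - ω₁s / n| ≤ δ₁ ∧
      |τ₂ - ω₂s / n| ≤ δ₂ ∧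
      x₁ (k * (2 * π)) = ρ₁ * C₁ τ₁ ∧ v₁ (k * (2 * π)) = ρ₁ * S₁ τ₁ ∧
      x₂ (k * (2 * π)) = ρ₂ * C₂ τ₂ ∧ v₂ (k * (2 * π)) = ρ₂ * S₂ τ₂) ∧
      (k : ℝ) ≤ ρ₁ ^ 2 ∧ (k : ℝ) ≤ ρ₂ ^ 2 := by
    intro k
    induction k with
    | zero =>
      obtain ⟨⟨ρ₁, τ₁, h1, h2, h3, h4⟩, ⟨ρ₂, τ₂, h5, h6, h7, h8⟩⟩ := hstart
      refine ⟨ρ₁, τ₁, ρ₂, τ₂, ⟨h1, h5, h2, h6, ?_, ?_, ?_, ?_⟩, ?_, ?_⟩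
      · simpa using h3
      · simpa using h4
      · simpa using h7
      · simpa using h8
      · simpa using sq_nonneg ρ₁
      · simpa using sq_nonneg ρ₂
    | succ k ih =>
      obtain ⟨ρ₁, τ₁, ρ₂, τ₂, ⟨h1, h2, h3, h4, h5, h6, h7, h8⟩, g1, g2⟩ := ih
      obtain ⟨-, -, ⟨ρ₁', τ₁', i1, i2, i3, i4, i5⟩, ⟨ρ₂', τ₂', j1, j2, j3, j4, j5⟩⟩ :=
        one k ρ₁ τ₁ ρ₂ τ₂ h1 h2 h3 h4 h5 h6 h7 h8
      have e : ((k + 1 : ℕ) : ℝ) * (2 * π) = 2 * π + k * (2 * π) := by push_cast; ring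
      refine ⟨ρ₁', τ₁', ρ₂', τ₂', ⟨grow _ _ h1 i2 i3, grow _ _ h2 j2 j3, i1, j1, ?_, ?_, ?_, ?_⟩,
        ?_, ?_⟩
      · rw [e]; exact i4
      · rw [e]; exact i5
      · rw [e]; exact j4
      · rw [e]; exact j5
      · push_cast; linarith
      · push_cast; linarith
  constructor
  · apply o₁.tendsto (K := K₁')
    intro k
    obtain ⟨ρ₁, τ₁, ρ₂, τ₂, ⟨h1, h2, h3, h4, h5, h6, h7, h8⟩, g1, g2⟩ := all k
    exact ⟨ρ₁, τ₁, g1, (one k ρ₁ τ₁ ρ₂ τ₂ h1 h2 h3 h4 h5 h6 h7 h8).1⟩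
  · apply o₂.tendsto (K := K₂')
    intro k
    obtain ⟨ρ₁, τ₁, ρ₂, τ₂, ⟨h1, h2, h3, h4, h5, h6, h7, h8⟩, g1, g2⟩ := all k
    exact ⟨ρ₂, τ₂, g2, (one k ρ₁ τ₁ ρ₂ τ₂ h1 h2 h3 h4 h5 h6 h7 h8).2.1⟩
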